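/- Let P ∈ 𝒫ₙ \ {I^{⊗n}} and let Û be the channel representation of R(P). If a diagonal entry Û_{rr} equals 1/√2, then there is exactly one index ℓ ≠ r such that Û_{rℓ} ≠ 0; for this ℓ one has Û_{rℓ} = ε/√2 with ε ∈ {+1,−1}, Û_{ℓr} = −ε/√2, and Û_{ℓℓ} = 1/√2, and all other entries in row r and column r of Û are 0. -/

import Mathlib

open Matrix Complex

/-- The four single-qubit Pauli matrices I, X, Y, Z. -/
noncomputable def pauli : Fin 4 → Matrix (Fin 2) (Fin 2) ℂ :=
  ![1, !![0, 1; 1, 0], !![0, -Complex.I; Complex.I, 0], !![1, 0; 0, -1]]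

/-- The n-qubit Pauli matrix A₁ ⊗ ⋯ ⊗ Aₙ (Kronecker product realized entrywise
on the index type `Fin n → Fin 2`). -/
noncomputable def nPauli {n : ℕ} (A : Fin n → Fin 4) :
    Matrix (Fin n → Fin 2) (Fin n → Fin 2) ℂ :=
  fun x y => ∏ j, pauli (A j) (x j) (y j)

/-- R(P) = ½(1+e^{iπ/4})·I + ½(1−e^{iπ/4})·P. -/
noncomputable def RP {n : ℕ} (A : Fin n → Fin 4) :
    Matrix (Fin n → Fin 2) (Fin n → Fin 2) ℂ :=
  ((1 + Complex.exp (Complex.I * Real.pi / 4)) / 2) • 1 +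
    ((1 - Complex.exp (Complex.I * Real.pi / 4)) / 2) • nPauli A

/-- The channel representation: Û_{rs} = (1/2ⁿ)·Tr(P_r U P_s U†). -/
noncomputable def chanRep {n : ℕ} (U : Matrix (Fin n → Fin 2) (Fin n → Fin 2) ℂ) :
    Matrix (Fin n → Fin 4) (Fin n → Fin 4) ℂ :=
  fun r s => (1 / 2 ^ n : ℂ) * (nPauli r * U * nPauli s * Uᴴ).trace

theorem pauli_mul_self (a : Fin 4) : pauli a * pauli a = 1 := by
  fin_cases a <;> ext i j <;> fin_cases i <;> fin_cases j <;> simp [pauli]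

theorem pauli_conjTranspose (a : Fin 4) : (pauli a)ᴴ = pauli a := by
  fin_cases a <;> ext i j <;> fin_cases i <;> fin_cases j <;> simp [pauli]

theorem trace_pauli_mul_pauli (a b : Fin 4) :
    (pauli a * pauli b).trace = if a = b then 2 else 0 := by
  fin_cases a <;> fin_cases b <;> simp [pauli, Matrix.trace_fin_two] <;> norm_num

theorem pauli_mul_comm_sign (a b : Fin 4) :
    ∃ s : ℂ, (s = 1 ∨ s = -1) ∧ pauli a * pauli b = s • (pauli b * pauli a) := by
  by_cases h : a = 0 ∨ b = 0 ∨ a = b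
  · refine ⟨1, Or.inl rfl, ?_⟩
    rcases h with rfl | rfl | rfl <;> simp [pauli]
  · refine ⟨-1, Or.inr rfl, ?_⟩
    fin_cases a <;> fin_cases b <;> simp [pauli] at h ⊢

/-- The index of the Pauli matrix proportional to a product of two Pauli matrices. -/
def pauliMulIndex : Fin 4 → Fin 4 → Fin 4 :=
  ![![0, 1, 2, 3], ![1, 0, 3, 2], ![2, 3, 0, 1], ![3, 2, 1, 0]]

/-- The phase of a product of two Pauli matrices. -/
noncomputable def pauliMulPhase : Fin 4 → Fin 4 → ℂ :=
  ![![1, 1, 1, 1], ![1, 1, I, -I], ![1, -I, 1, I], ![1, I, -I, 1]]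

theorem pauli_mul_pauli (a b : Fin 4) :
    pauli a * pauli b = pauliMulPhase a b • pauli (pauliMulIndex a b) := by
  fin_cases a <;> fin_cases b <;> simp [pauli, pauliMulPhase, pauliMulIndex, Matrix.one_fin_two]

section nPauli

variable {n : ℕ}

theorem nPauli_mul_apply (A B : Fin n → Fin 4) (x y : Fin n → Fin 2) :
    (nPauli A * nPauli B) x y = ∏ j, (pauli (A j) * pauli (B j)) (x j) (y j) := by
  simp only [Matrix.mul_apply, nPauli, Finset.prod_univ_sum, Fintype.piFinset_univ,
    Finset.prod_mul_distrib]

theorem nPauli_mul_self (A : Fin n → Fin 4) : nPauli A * nPauli A = 1 := by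
  ext x y
  simp only [nPauli_mul_apply, pauli_mul_self, Matrix.one_apply, funext_iff,
    Finset.prod_ite_zero, Finset.mem_univ, true_implies, Finset.prod_const_one]

theorem nPauli_conjTranspose (A : Fin n → Fin 4) : (nPauli A)ᴴ = nPauli A := by
  ext x y
  simp only [Matrix.conjTranspose_apply, nPauli, star_prod]
  exact Finset.prod_congr rfl fun j _ => congrFun₂ (pauli_conjTranspose (A j)) (x j) (y j)

theorem trace_nPauli_mul_nPauli (A B : Fin n → Fin 4) :
    (nPauli A * nPauli B).trace = if A = B then 2 ^ n else 0 := by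
  have h : (nPauli A * nPauli B).trace = ∏ j, (pauli (A j) * pauli (B j)).trace := by
    simp only [Matrix.trace, Matrix.diag, nPauli_mul_apply, Finset.prod_univ_sum,
      Fintype.piFinset_univ]
  simp [h, trace_pauli_mul_pauli, Finset.prod_ite_zero, funext_iff]

theorem nPauli_mul_comm_sign (A B : Fin n → Fin 4) :
    nPauli A * nPauli B = nPauli B * nPauli A ∨
      nPauli A * nPauli B = -(nPauli B * nPauli A) := by
  choose s hs h using fun j => pauli_mul_comm_sign (A j) (B j)
  have hprod : nPauli A * nPauli B = (∏ j, s j) • (nPauli B * nPauli A) := by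
    ext x y
    simp only [Matrix.smul_apply, nPauli_mul_apply, h, smul_eq_mul, Finset.prod_mul_distrib]
  have hsign : ∏ j, s j = 1 ∨ ∏ j, s j = -1 := by
    rw [← sq_eq_one_iff, ← Finset.prod_pow]
    exact Finset.prod_eq_one fun j _ => sq_eq_one_iff.mpr (hs j)
  rcases hsign with hs | hs <;> rw [hs] at hprod
  · exact Or.inl (by simpa using hprod)
  · exact Or.inr (by simpa using hprod)

theorem exists_nPauli_mul_eq_smul (A B : Fin n → Fin 4) :
    ∃ (l : Fin n → Fin 4) (c : ℂ), nPauli A * nPauli B = c • nPauli l := by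
  refine ⟨fun j => pauliMulIndex (A j) (B j), ∏ j, pauliMulPhase (A j) (B j), ?_⟩
  ext x y
  simp only [nPauli_mul_apply, pauli_mul_pauli, Matrix.smul_apply, smul_eq_mul,
    Finset.prod_mul_distrib, nPauli]

end nPauli

theorem add_smul_mul_mul_of_commute {R : Type*} [Ring R] [Algebra ℂ R] {P Q : R}
    (hP : P * P = 1) (hPQ : P * Q = Q * P) (a b c d : ℂ) :
    (a • 1 + b • P) * Q * (c • 1 + d • P) = (a * c + b * d) • Q + (b * c + a * d) • (P * Q) := by
  have h : P * Q * P = Q := by rw [hPQ, mul_assoc, hP, mul_one]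
  simp only [add_mul, mul_add, smul_mul_assoc, mul_smul_comm, one_mul, mul_one, h, ← hPQ]
  module

theorem add_smul_mul_mul_of_anticommute {R : Type*} [Ring R] [Algebra ℂ R] {P Q : R}
    (hP : P * P = 1) (hPQ : P * Q = -(Q * P)) (a b c d : ℂ) :
    (a • 1 + b • P) * Q * (c • 1 + d • P) = (a * c - b * d) • Q + (b * c - a * d) • (P * Q) := by
  have h : P * Q * P = -Q := by rw [hPQ, neg_mul, mul_assoc, hP, mul_one]
  have h' : Q * P = -(P * Q) := by rw [hPQ, neg_neg]
  simp only [add_mul, mul_add, smul_mul_assoc, mul_smul_comm, one_mul, mul_one, h, h']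
  module

theorem inv_sqrt_two_mul_self : (Real.sqrt 2 : ℂ)⁻¹ * (Real.sqrt 2 : ℂ)⁻¹ = 1 / 2 := by
  rw [← mul_inv, ← Complex.ofReal_mul, Real.mul_self_sqrt (by norm_num)]
  norm_num

theorem exp_I_mul_pi_div_four :
    Complex.exp (I * Real.pi / 4) = (Real.sqrt 2 : ℂ)⁻¹ + (Real.sqrt 2 : ℂ)⁻¹ * I := by
  have h2 : (Real.sqrt 2 : ℂ)⁻¹ = Real.sqrt 2 / 2 := by
    have h : (Real.sqrt 2 : ℂ) * Real.sqrt 2 = 2 := by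
      rw [← Complex.ofReal_mul, Real.mul_self_sqrt (by norm_num)]
      norm_num
    have h0 : (Real.sqrt 2 : ℂ) ≠ 0 := by
      rintro h0
      simp [h0] at h
    field_simp
    linear_combination -h
  have h : I * Real.pi / 4 = ((Real.pi / 4 : ℝ) : ℂ) * I := by
    push_cast
    ring
  rw [h, Complex.exp_mul_I, ← Complex.ofReal_cos, ← Complex.ofReal_sin, Real.cos_pi_div_four,
    Real.sin_pi_div_four, h2]
  push_cast
  ring

section RP

variable {n : ℕ} (A : Fin n → Fin 4)

theorem RP_eq : RP A =
    ((1 + ((Real.sqrt 2 : ℂ)⁻¹ + (Real.sqrt 2 : ℂ)⁻¹ * I)) / 2) • 1 +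
      ((1 - ((Real.sqrt 2 : ℂ)⁻¹ + (Real.sqrt 2 : ℂ)⁻¹ * I)) / 2) • nPauli A := by
  rw [RP, exp_I_mul_pi_div_four]

theorem RP_conjTranspose : (RP A)ᴴ =
    ((1 + ((Real.sqrt 2 : ℂ)⁻¹ - (Real.sqrt 2 : ℂ)⁻¹ * I)) / 2) • 1 +
      ((1 - ((Real.sqrt 2 : ℂ)⁻¹ - (Real.sqrt 2 : ℂ)⁻¹ * I)) / 2) • nPauli A := by
  rw [RP_eq, Matrix.conjTranspose_add, Matrix.conjTranspose_smul, Matrix.conjTranspose_smul,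
    nPauli_conjTranspose, Matrix.conjTranspose_one]
  simp [sub_eq_add_neg]

variable {A} {Q : Matrix (Fin n → Fin 2) (Fin n → Fin 2) ℂ}

theorem RP_conj_of_commute (h : nPauli A * Q = Q * nPauli A) : RP A * Q * (RP A)ᴴ = Q := by
  rw [RP_conjTranspose, RP_eq, add_smul_mul_mul_of_commute (nPauli_mul_self A) h]
  convert add_zero Q
  · convert one_smul ℂ Q
    linear_combination (1 - I ^ 2) / 2 * inv_sqrt_two_mul_self - 1 / 4 * I_sq
  · convert zero_smul ℂ (nPauli A * Q)
    linear_combination (I ^ 2 - 1) / 2 * inv_sqrt_two_mul_self + 1 / 4 * I_sq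

theorem RP_conj_of_anticommute (h : nPauli A * Q = -(Q * nPauli A)) :
    RP A * Q * (RP A)ᴴ =
      (Real.sqrt 2 : ℂ)⁻¹ • Q - ((Real.sqrt 2 : ℂ)⁻¹ * I) • (nPauli A * Q) := by
  rw [RP_conjTranspose, RP_eq, add_smul_mul_mul_of_anticommute (nPauli_mul_self A) h]
  module

theorem RP_conj_symm_of_anticommute (h : nPauli A * Q = -(Q * nPauli A)) :
    (RP A)ᴴ * Q * RP A =
      (Real.sqrt 2 : ℂ)⁻¹ • Q + ((Real.sqrt 2 : ℂ)⁻¹ * I) • (nPauli A * Q) := by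
  rw [RP_conjTranspose, RP_eq, add_smul_mul_mul_of_anticommute (nPauli_mul_self A) h]
  module

end RP

section chanRep

variable {n : ℕ} {A r l : Fin n → Fin 4} {c : ℂ}

theorem chanRep_RP_self_of_commute (h : nPauli A * nPauli r = nPauli r * nPauli A) :
    chanRep (RP A) r r = 1 := by
  rw [chanRep, mul_assoc, mul_assoc, ← mul_assoc (RP A), RP_conj_of_commute h,
    trace_nPauli_mul_nPauli]
  simp

theorem chanRep_RP_col_of_anticommute (h : nPauli A * nPauli r = -(nPauli r * nPauli A))
    (hl : nPauli A * nPauli r = c • nPauli l) (s : Fin n → Fin 4) :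
    chanRep (RP A) s r =
      (Real.sqrt 2 : ℂ)⁻¹ * ((if s = r then 1 else 0) - I * c * if s = l then 1 else 0) := by
  rw [chanRep, mul_assoc, mul_assoc, ← mul_assoc (RP A), RP_conj_of_anticommute h, hl]
  simp only [mul_sub, Matrix.mul_smul, Matrix.trace_sub, Matrix.trace_smul,
    trace_nPauli_mul_nPauli, smul_eq_mul]
  have h2 : (2 : ℂ) ^ n ≠ 0 := pow_ne_zero n two_ne_zero
  split_ifs <;> field_simp <;> ring

theorem chanRep_RP_row_of_anticommute (h : nPauli A * nPauli r = -(nPauli r * nPauli A))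
    (hl : nPauli A * nPauli r = c • nPauli l) (s : Fin n → Fin 4) :
    chanRep (RP A) r s =
      (Real.sqrt 2 : ℂ)⁻¹ * ((if s = r then 1 else 0) + I * c * if s = l then 1 else 0) := by
  rw [chanRep, Matrix.trace_mul_comm, ← mul_assoc, ← mul_assoc, RP_conj_symm_of_anticommute h, hl,
    Matrix.trace_mul_comm]
  simp only [mul_add, Matrix.mul_smul, Matrix.trace_add, Matrix.trace_smul,
    trace_nPauli_mul_nPauli, smul_eq_mul]
  have h2 : (2 : ℂ) ^ n ≠ 0 := pow_ne_zero n two_ne_zero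
  split_ifs <;> field_simp <;> ring

end chanRep

/-- if Û_{rr} = 1/√2 then there is exactly one ℓ ≠ r with Û_{rℓ} ≠ 0;
for it Û_{rℓ} = ε/√2 (ε = ±1), Û_{ℓr} = −ε/√2, Û_{ℓℓ} = 1/√2, and all other entries
of row r and column r vanish. -/
theorem chanRep_diag_sqrt2_row_col {n : ℕ} (A : Fin n → Fin 4) (hA : A ≠ 0)
    (r : Fin n → Fin 4) (hr : chanRep (RP A) r r = (Real.sqrt 2 : ℂ)⁻¹) :
    ∃ ℓ : Fin n → Fin 4, ℓ ≠ r ∧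
      (∃ ε : ℂ, (ε = 1 ∨ ε = -1) ∧
        chanRep (RP A) r ℓ = ε * (Real.sqrt 2 : ℂ)⁻¹ ∧
        chanRep (RP A) ℓ r = -ε * (Real.sqrt 2 : ℂ)⁻¹) ∧
      chanRep (RP A) ℓ ℓ = (Real.sqrt 2 : ℂ)⁻¹ ∧
      (∀ s : Fin n → Fin 4, s ≠ r → s ≠ ℓ →
        chanRep (RP A) r s = 0 ∧ chanRep (RP A) s r = 0) := by
  have ht : (Real.sqrt 2 : ℂ)⁻¹ ≠ 0 := fun h => by
    have h2 := inv_sqrt_two_mul_self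
    rw [h] at h2
    norm_num at h2
  have hanti : nPauli A * nPauli r = -(nPauli r * nPauli A) := by
    refine (nPauli_mul_comm_sign A r).resolve_left fun hcomm => ?_
    have h2 := inv_sqrt_two_mul_self
    rw [← hr, chanRep_RP_self_of_commute hcomm] at h2
    norm_num at h2
  obtain ⟨ℓ, c, hl⟩ := exists_nPauli_mul_eq_smul A r
  have hc : c * c = -1 := by
    have h1 : (nPauli A * nPauli r) * (nPauli A * nPauli r) = -1 := by
      nth_rewrite 1 [hanti]
      rw [neg_mul, mul_assoc, ← mul_assoc (nPauli A), nPauli_mul_self, one_mul, nPauli_mul_self]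
    rw [hl, smul_mul_smul_comm, nPauli_mul_self] at h1
    simpa using congrFun₂ h1 0 0
  have hc0 : c ≠ 0 := by
    rintro rfl
    simp at hc
  have hcol := chanRep_RP_col_of_anticommute hanti hl
  have hrow := chanRep_RP_row_of_anticommute hanti hl
  have hne : ℓ ≠ r := by
    rintro rfl
    rw [hrow] at hr
    simp [ht, hc0] at hr
  have hAl : nPauli A * nPauli ℓ = (-c) • nPauli r := by
    have h1 : c • (nPauli A * nPauli ℓ) = nPauli r := by
      rw [← Matrix.mul_smul, ← hl, ← mul_assoc, nPauli_mul_self, one_mul]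
    rw [← h1, smul_smul, neg_mul, hc, neg_neg, one_smul]
  have hantil : nPauli A * nPauli ℓ = -(nPauli ℓ * nPauli A) := by
    have h1 : c • (nPauli ℓ * nPauli A) = c • (c • nPauli r) := by
      rw [← Matrix.smul_mul, ← hl, hanti, neg_mul, mul_assoc, nPauli_mul_self, mul_one, smul_smul,
        hc, neg_one_smul]
    rw [hAl, smul_right_injective _ hc0 h1, neg_smul]
  refine ⟨ℓ, hne, ⟨I * c, ?_, ?_, ?_⟩, ?_, fun s hsr hsl => ?_⟩
  · rw [← sq_eq_one_iff]
    linear_combination I ^ 2 * hc - I_sq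
  · simp [hrow, hne, mul_comm]
  · simp [hcol, hne, mul_comm]
  · simp [chanRep_RP_row_of_anticommute hantil hAl, hne]
  · simp [hrow, hcol, hsr, hsl]
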